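/- Let 0 < c1 < c2 and 0 < D < c1 + c2, with latency functions ℓ_p(f) = 1/(c_p − f) for f < c_p. Define f^WE = (0, D) if D ≤ c2 − c1, and f^WE = ((D + c1 − c2)/2, (D + c2 − c1)/2) otherwise. Then f^WE is a feasible flow assignment (both components are nonnegative, sum to D, and each component f_p satisfies f_p < c_p), and it satisfies the Wardrop equilibrium condition without taxes: for each network p ∈ {1,2}, if the p-th component of f^WE is strictly positive then ℓ_p(f^WE_p) ≤ ℓ_{p'}(f^WE_{p'}) for the other network p'. -/

import Mathlib

/-- The flow assignment `f^WE` (given by `(0, D)` if `D ≤ c2 - c1`, and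
`((D + c1 - c2)/2, (D + c2 - c1)/2)` otherwise) is feasible (nonnegative
components summing to `D`, each strictly below the corresponding capacity)
and satisfies the Wardrop equilibrium condition without taxes for the
M/M/1 latencies `ℓ_p(f) = 1/(c_p - f)`. -/
theorem wardrop_equilibrium_no_tax_exists
    (c1 c2 D : ℝ) (hc1 : 0 < c1) (hc12 : c1 < c2)
    (hD : 0 < D) (hDlt : D < c1 + c2)
    (f1 f2 : ℝ)
    (hf1 : f1 = if D ≤ c2 - c1 then 0 else (D + c1 - c2) / 2)
    (hf2 : f2 = if D ≤ c2 - c1 then D else (D + c2 - c1) / 2) :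
    (0 ≤ f1 ∧ 0 ≤ f2 ∧ f1 + f2 = D ∧ f1 < c1 ∧ f2 < c2) ∧
    (0 < f1 → 1 / (c1 - f1) ≤ 1 / (c2 - f2)) ∧
    (0 < f2 → 1 / (c2 - f2) ≤ 1 / (c1 - f1)) := by
  by_cases h : D ≤ c2 - c1
  · rw [if_pos h] at hf1 hf2
    refine ⟨⟨by linarith, by linarith, by linarith, by linarith, by linarith⟩, ?_, ?_⟩
    · intro h0
      linarith
    · intro _
      exact one_div_le_one_div_of_le (by linarith) (by linarith)
  · rw [if_neg h] at hf1 hf2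
    have h' := not_le.mp h
    refine ⟨⟨by linarith, by linarith, by linarith, by linarith, by linarith⟩, ?_, ?_⟩
    · intro _
      exact one_div_le_one_div_of_le (by linarith) (by linarith)
    · intro _
      exact one_div_le_one_div_of_le (by linarith) (by linarith)
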